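/- arXiv:1902.04731 — 7 statements merged into one kernel-verified Lean document; each statement's English description precedes it below -/
import Mathlib

section
/- Given δ > 0, there exist constants C, c > 0 (depending only on δ) such that the following holds for all positive integers n, m, r, s with s ≤ n and m ≥ C·r·s·ln(e·n/s): if A₁, …, A_m are independent random n×n matrices whose entries are independent Gaussian N(0, 1/m) random variables, then with probability at least 1 − 2·exp(−c·m), the linear map 𝒜(Z) = (⟨Z, A₁⟩_F, …, ⟨Z, A_m⟩_F) satisfies (1−δ)·‖Z‖_F² ≤ ‖𝒜(Z)‖₂² ≤ (1+δ)·‖Z‖_F² simultaneously for all Z ∈ Σ_{(s)}^{[r]}. -/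
open Matrix Finset MeasureTheory
open scoped ENNReal NNReal

/-- Frobenius norm of a real `n × n` matrix. -/
noncomputable def frobNorm {n : ℕ} (M : Matrix (Fin n) (Fin n) ℝ) : ℝ :=
  Real.sqrt (∑ i, ∑ j, (M i j) ^ 2)

/-- Frobenius inner product `⟨A, B⟩_F = tr(Aᵀ B)`. -/
def frobInner {n : ℕ} (A B : Matrix (Fin n) (Fin n) ℝ) : ℝ :=
  ∑ i, ∑ j, A i j * B i j

/-- Euclidean (ℓ₂) norm on `ℝ^m`. -/
noncomputable def l2norm {m : ℕ} (y : Fin m → ℝ) : ℝ :=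
  Real.sqrt (∑ i, (y i) ^ 2)

/-- ℓ₁ norm on `ℝ^m`. -/
def l1norm {m : ℕ} (y : Fin m → ℝ) : ℝ := ∑ i, |y i|

/-- `restr M S T` is the matrix equal to `M` on entries `(i,j)` with `i ∈ S`, `j ∈ T`,
and zero elsewhere. -/
def restr {n : ℕ} (M : Matrix (Fin n) (Fin n) ℝ) (S T : Finset (Fin n)) :
    Matrix (Fin n) (Fin n) ℝ :=
  Matrix.of fun i j => if i ∈ S ∧ j ∈ T then M i j else 0

/-- `Σ_{(s)}^{[r]}`: symmetric matrices of rank at most `r` supported on `S × S` for some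
index set `S` of cardinality `s`. -/
def SigmaRS (n r s : ℕ) : Set (Matrix (Fin n) (Fin n) ℝ) :=
  {M | M.IsSymm ∧ M.rank ≤ r ∧ ∃ S : Finset (Fin n), S.card = s ∧ M = restr M S S}

/-- `Y` is a best rank-`r` Frobenius approximation of `A`. -/
noncomputable def IsBestRankApprox {n : ℕ} (r : ℕ) (A Y : Matrix (Fin n) (Fin n) ℝ) : Prop :=
  Y.rank ≤ r ∧
    ∀ Z : Matrix (Fin n) (Fin n) ℝ, Z.rank ≤ r → frobNorm (A - Y) ≤ frobNorm (A - Z)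

open ProbabilityTheory

theorem map_sum_pi_eq_gaussianReal {ι κ Ω : Type*} [Fintype ι] [Fintype κ] [MeasurableSpace Ω]
    (μ : ι → Measure Ω) [∀ i, IsProbabilityMeasure (μ i)] {e : κ → ι} (he : e.Injective)
    {f : κ → Ω → ℝ} (hf : ∀ k, Measurable (f k)) {v : κ → ℝ≥0}
    (hv : ∀ k, (μ (e k)).map (f k) = gaussianReal 0 (v k)) :
    (Measure.pi μ).map (fun ω => ∑ k, f k (ω (e k))) = gaussianReal 0 (∑ k, v k) := by
  have hind : iIndepFun (fun k (ω : ι → Ω) => f k (ω (e k))) (Measure.pi μ) :=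
    ((iIndepFun_pi (μ := μ) (X := fun _ => id) fun _ => aemeasurable_id).precomp he).comp f hf
  have hm : ∀ k, Measurable fun ω : ι → Ω => f k (ω (e k)) := fun k =>
    (hf k).comp (measurable_pi_apply (e k))
  have hlaw : ∀ k, (Measure.pi μ).map (fun ω : ι → Ω => f k (ω (e k))) = gaussianReal 0 (v k) := by
    intro k
    rw [← hv k, ← (measurePreserving_eval μ (e k)).map_eq,
      Measure.map_map (hf k) (measurable_pi_apply (e k))]
    rfl
  have : IsProbabilityMeasure ((Measure.pi μ).map (fun ω => ∑ k, f k (ω (e k)))) :=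
    Measure.isProbabilityMeasure_map (Finset.measurable_fun_sum _ fun k _ => hm k).aemeasurable
  refine Measure.ext_of_charFun ?_
  rw [hind.charFun_map_fun_sum_eq_prod fun k => (hm k).aemeasurable]
  ext t
  simp only [Finset.prod_apply, hlaw, charFun_gaussianReal, ← Complex.exp_sum]
  congr 1
  simp [Finset.sum_div, Finset.sum_mul]

theorem map_bilin_pi_pi_eq_gaussianReal {ι κ : Type*} [Fintype ι] [Fintype κ] {e : κ → ι}
    (he : e.Injective) (v : ℝ≥0) (W : κ → κ → ℝ) :
    (Measure.pi fun _ : ι => Measure.pi fun _ : ι => gaussianReal 0 v).map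
        (fun x => ∑ a, ∑ b, W a b * x (e a) (e b)) =
      gaussianReal 0 ((∑ a, ∑ b, ‖W a b‖₊ ^ 2) * v) := by
  simp_rw [Finset.sum_mul]
  refine map_sum_pi_eq_gaussianReal _ he (f := fun a (y : ι → ℝ) => ∑ b, W a b * y (e b))
    (fun a => by fun_prop) fun a => ?_
  refine map_sum_pi_eq_gaussianReal _ he (f := fun b y => W a b * y) (fun b => by fun_prop)
    fun b => ?_
  rw [gaussianReal_map_const_mul, mul_zero]
  congr 2
  ext; simp

theorem integral_exp_mul_sq_gaussianReal {v : ℝ≥0} (hv : v ≠ 0) {l : ℝ} (hl : 2 * l * v < 1) :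
    ∫ x, Real.exp (l * x ^ 2) ∂gaussianReal 0 v = (√(1 - 2 * l * v))⁻¹ := by
  have hv' : (0 : ℝ) < v := by positivity
  have h1 : 0 < 1 - 2 * l * v := by linarith
  rw [integral_gaussianReal_eq_integral_smul hv]
  have : ∀ x : ℝ, gaussianPDFReal 0 v x • Real.exp (l * x ^ 2) =
      (√(2 * Real.pi * v))⁻¹ * Real.exp (-((1 - 2 * l * v) / (2 * v)) * x ^ 2) := by
    intro x
    rw [gaussianPDFReal, smul_eq_mul, mul_assoc, ← Real.exp_add]
    congr 2
    field_simp
    ring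
  simp_rw [this]
  rw [integral_const_mul, integral_gaussian, ← Real.sqrt_inv, ← Real.sqrt_mul (by positivity),
    ← Real.sqrt_inv]
  congr 1
  field_simp

theorem integrable_exp_mul_sq_gaussianReal {v : ℝ≥0} (hv : v ≠ 0) {l : ℝ} (hl : 2 * l * v < 1) :
    Integrable (fun x => Real.exp (l * x ^ 2)) (gaussianReal 0 v) := by
  by_contra h
  have h1 := integral_exp_mul_sq_gaussianReal hv hl
  rw [integral_undef h] at h1
  have : 0 < (√(1 - 2 * l * v))⁻¹ := by
    have : 0 < 1 - 2 * l * v := by linarith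
    positivity
  linarith

section

variable {Ω : Type*} [MeasurableSpace Ω] {μ : Measure Ω} {m : ℕ} {X : Fin m → Ω → ℝ} {v : ℝ≥0}

theorem integrable_exp_mul_sum_sq (hX : ∀ i, Measurable (X i)) (hind : iIndepFun X μ)
    (hlaw : ∀ i, μ.map (X i) = gaussianReal 0 v) (hv : v ≠ 0) {l : ℝ} (hl : 2 * l * v < 1) :
    Integrable (fun ω => Real.exp (l * ∑ i, X i ω ^ 2)) μ := by
  have : IsProbabilityMeasure μ := hind.isProbabilityMeasure
  have hind' : iIndepFun (fun i ω => X i ω ^ 2) μ :=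
    hind.comp (fun _ x => x ^ 2) fun _ => by fun_prop
  have := hind'.integrable_exp_mul_sum (t := l) (s := Finset.univ) (fun i => (hX i).pow_const 2)
    fun i _ => by
      have := integrable_exp_mul_sq_gaussianReal hv hl
      rw [← hlaw i] at this
      exact this.comp_measurable (hX i)
  simpa using this

theorem mgf_sum_sq (hX : ∀ i, Measurable (X i)) (hind : iIndepFun X μ)
    (hlaw : ∀ i, μ.map (X i) = gaussianReal 0 v) (hv : v ≠ 0) {l : ℝ} (hl : 2 * l * v < 1) :
    mgf (fun ω => ∑ i, X i ω ^ 2) μ l = ((√(1 - 2 * l * v))⁻¹) ^ m := by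
  have hind' : iIndepFun (fun i ω => X i ω ^ 2) μ :=
    hind.comp (fun _ x => x ^ 2) fun _ => by fun_prop
  have h := hind'.mgf_sum (t := l) (fun i => (hX i).pow_const 2) Finset.univ
  have h2 : (∑ i, fun ω => X i ω ^ 2) = fun ω => ∑ i, X i ω ^ 2 := by ext; simp
  rw [h2] at h
  rw [h, Finset.prod_eq_pow_card (b := (√(1 - 2 * l * v))⁻¹), Finset.card_univ, Fintype.card_fin]
  intro i _
  rw [← integral_exp_mul_sq_gaussianReal hv hl, ← hlaw i, integral_map (hX i).aemeasurable
    (by fun_prop), mgf]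

end

theorem exists_chi_sq_upper_tail {t : ℝ} (ht : 0 < t) :
    ∃ c : ℝ, 0 < c ∧ ∀ {Ω : Type*} [MeasurableSpace Ω] {μ : Measure Ω} {m : ℕ} {X : Fin m → Ω → ℝ}
      {v : ℝ≥0}, (∀ i, Measurable (X i)) → iIndepFun X μ →
      (∀ i, μ.map (X i) = gaussianReal 0 v) → v ≠ 0 →
      μ.real {ω | (1 + t) * (m * v) ≤ ∑ i, X i ω ^ 2} ≤ Real.exp (-c * m) := by
  set x := t / (2 * (1 + t)) with hx
  have hx0 : 0 < x := by positivity
  have hxt : x * (1 + t) = t / 2 := by rw [hx]; field_simp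
  have hx1 : x < 1 := by rw [hx, div_lt_one (by positivity)]; linarith
  have h1x : 0 < 1 - x := by linarith
  have key : 0 < x * (1 + t) + Real.log (1 - x) := by
    rw [← neg_lt_iff_pos_add', Real.lt_log_iff_exp_lt h1x]
    rw [Real.exp_neg]
    refine (inv_le_of_inv_le₀ (by positivity) ?_ : _ ≤ (1 + t / 2)⁻¹).trans_lt ?_
    · rw [inv_inv, hxt]; linarith [Real.add_one_le_exp (t / 2)]
    · rw [inv_lt_iff_one_lt_mul₀ (by positivity)]
      nlinarith
  refine ⟨(x * (1 + t) + Real.log (1 - x)) / 2, by positivity, ?_⟩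
  intro Ω _ μ m X v hX hind hlaw hv
  have : IsProbabilityMeasure μ := hind.isProbabilityMeasure
  have hv' : (0 : ℝ) < v := by positivity
  have hl : 2 * (x / (2 * v)) * v = x := by field_simp
  have h := measure_ge_le_exp_mul_mgf (μ := μ) (X := fun ω => ∑ i, X i ω ^ 2)
    (t := x / (2 * v)) ((1 + t) * (m * v)) (by positivity)
    (integrable_exp_mul_sum_sq hX hind hlaw hv (by linarith))
  refine h.trans (le_of_eq ?_)
  rw [mgf_sum_sq hX hind hlaw hv (by linarith), hl, ← Real.exp_log (x := (√(1 - x))⁻¹)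
    (by positivity), ← Real.exp_nat_mul, ← Real.exp_add, Real.log_inv, Real.log_sqrt h1x.le]
  congr 1
  field_simp
  ring

theorem exists_chi_sq_lower_tail {t : ℝ} (ht : 0 < t) (ht1 : t < 1) :
    ∃ c : ℝ, 0 < c ∧ ∀ {Ω : Type*} [MeasurableSpace Ω] {μ : Measure Ω} {m : ℕ} {X : Fin m → Ω → ℝ}
      {v : ℝ≥0}, (∀ i, Measurable (X i)) → iIndepFun X μ →
      (∀ i, μ.map (X i) = gaussianReal 0 v) → v ≠ 0 →
      μ.real {ω | ∑ i, X i ω ^ 2 ≤ (1 - t) * (m * v)} ≤ Real.exp (-c * m) := by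
  have h1t : 0 < 1 + t := by linarith
  have key : 0 < Real.log (1 + t) - t * (1 - t) := by
    rw [sub_pos, Real.lt_log_iff_exp_lt h1t]
    rw [← inv_inv (Real.exp _), ← Real.exp_neg]
    have h0 : 0 < 1 - t * (1 - t) := by nlinarith
    refine (inv_anti₀ h0 ?_ : _ ≤ (1 - t * (1 - t))⁻¹).trans_lt ?_
    · linarith [Real.add_one_le_exp (-(t * (1 - t)))]
    · rw [inv_lt_iff_one_lt_mul₀ h0]
      nlinarith [pow_pos ht 3]
  refine ⟨(Real.log (1 + t) - t * (1 - t)) / 2, by positivity, ?_⟩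
  intro Ω _ μ m X v hX hind hlaw hv
  have : IsProbabilityMeasure μ := hind.isProbabilityMeasure
  have hv' : (0 : ℝ) < v := by positivity
  have hl : 2 * (-(t / (2 * v))) * v = -t := by field_simp
  have h := measure_le_le_exp_mul_mgf (μ := μ) (X := fun ω => ∑ i, X i ω ^ 2)
    (t := -(t / (2 * v))) ((1 - t) * (m * v)) (by rw [neg_nonpos]; positivity)
    (integrable_exp_mul_sum_sq hX hind hlaw hv (by linarith))
  refine h.trans (le_of_eq ?_)
  rw [mgf_sum_sq hX hind hlaw hv (by linarith), hl, sub_neg_eq_add,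
    ← Real.exp_log (x := (√(1 + t))⁻¹) (by positivity), ← Real.exp_nat_mul, ← Real.exp_add,
    Real.log_inv, Real.log_sqrt h1t.le]
  congr 1
  field_simp
  ring

theorem exists_finset_half_net (E : Type*) [NormedAddCommGroup E] [NormedSpace ℝ E]
    [FiniteDimensional ℝ E] :
    ∃ N : Finset E, N.card ≤ 5 ^ Module.finrank ℝ E ∧
      ∀ x : E, ‖x‖ ≤ 1 → ∃ y ∈ N, ‖x - y‖ ≤ 1 / 2 := by
  classical
  let P : ℕ → Prop := fun k => ∃ s : Finset E, s.card = k ∧ (∀ c ∈ s, ‖c‖ ≤ 2) ∧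
    ∀ c ∈ s, ∀ d ∈ s, c ≠ d → 1 ≤ ‖c - d‖
  have hP : ∀ k, P k → k ≤ 5 ^ Module.finrank ℝ E := by
    rintro k ⟨s, rfl, h2, h1⟩
    exact Besicovitch.card_le_of_separated s h2 h1
  have hmax : P (Nat.findGreatest P (5 ^ Module.finrank ℝ E)) :=
    Nat.findGreatest_spec (P := P) (m := 0) (Nat.zero_le _) ⟨∅, by simp⟩
  obtain ⟨s, hs, h2, h1⟩ := hmax
  refine ⟨s.image fun y => (1 / 2 : ℝ) • y, card_image_le.trans (hP _ ⟨s, rfl, h2, h1⟩), ?_⟩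
  intro x hx
  by_contra! hcon
  have hfar : ∀ y ∈ s, 1 < ‖(2 : ℝ) • x - y‖ := by
    intro y hy
    have := hcon _ (mem_image_of_mem _ hy)
    have h3 : (2 : ℝ) • x - y = (2 : ℝ) • (x - (1 / 2 : ℝ) • y) := by
      rw [smul_sub, smul_smul]; norm_num
    rw [h3, norm_smul]
    norm_num at this ⊢
    linarith
  have hnot : (2 : ℝ) • x ∉ s := fun h => by have := hfar _ h; norm_num at this
  have hP' : P (s.card + 1) := by
    refine ⟨insert ((2 : ℝ) • x) s, card_insert_of_notMem hnot, ?_, ?_⟩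
    · intro c hc
      rcases mem_insert.1 hc with rfl | hc
      · rw [norm_smul]; norm_num; linarith
      · exact h2 c hc
    · intro c hc d hd hcd
      rcases mem_insert.1 hc with rfl | hc <;> rcases mem_insert.1 hd with rfl | hd
      · exact absurd rfl hcd
      · exact (hfar d hd).le
      · rw [norm_sub_rev]; exact (hfar c hc).le
      · exact h1 c hc d hd hcd
  have := Nat.le_findGreatest (hP _ hP') hP'
  omega

theorem exists_finset_net (E : Type*) [NormedAddCommGroup E] [NormedSpace ℝ E]
    [FiniteDimensional ℝ E] (k : ℕ) :
    ∃ N : Finset E, N.card ≤ 5 ^ (Module.finrank ℝ E * k) ∧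
      ∀ x : E, ‖x‖ ≤ 1 → ∃ y ∈ N, ‖x - y‖ ≤ (1 / 2) ^ k := by
  classical
  induction k with
  | zero => exact ⟨{0}, by simp, by simp⟩
  | succ k ih =>
    obtain ⟨N, hN, hnet⟩ := ih
    obtain ⟨N₁, hN₁, hnet₁⟩ := exists_finset_half_net E
    refine ⟨(N ×ˢ N₁).image fun p => p.1 + ((1 / 2 : ℝ) ^ k) • p.2, ?_, ?_⟩
    · refine card_image_le.trans ?_
      rw [card_product, mul_add, mul_one, pow_add]
      gcongr
    · intro x hx
      obtain ⟨y, hy, hxy⟩ := hnet x hx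
      obtain ⟨z, hz, hyz⟩ := hnet₁ ((2 : ℝ) ^ k • (x - y)) (by
        rw [norm_smul]
        simp only [norm_pow, Real.norm_ofNat]
        calc (2 : ℝ) ^ k * ‖x - y‖ ≤ 2 ^ k * (1 / 2) ^ k := by gcongr
          _ = 1 := by rw [← mul_pow]; norm_num)
      refine ⟨_, mem_image_of_mem _ (mk_mem_product hy hz), ?_⟩
      have h : x - (y + ((1 / 2 : ℝ) ^ k) • z) =
          ((1 / 2 : ℝ) ^ k) • ((2 : ℝ) ^ k • (x - y) - z) := by
        rw [smul_sub, smul_smul, ← mul_pow]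
        norm_num
        abel
      simp only [h]
      rw [norm_smul, pow_succ]
      simp only [norm_pow, norm_div, norm_one, Real.norm_ofNat]
      gcongr

section

variable {E₁ E₂ F G : Type*} [NormedAddCommGroup E₁] [NormedSpace ℝ E₁]
  [NormedAddCommGroup E₂] [NormedSpace ℝ E₂]
  [NormedAddCommGroup F] [NormedSpace ℝ F] [NormedAddCommGroup G] [NormedSpace ℝ G]

theorem norm_sub_bilin_le {q : E₁ →ₗ[ℝ] E₂ →ₗ[ℝ] F} {Q : ℝ} (hQ : 0 ≤ Q)
    (hq : ∀ u b, ‖q u b‖ ≤ Q * ‖u‖ * ‖b‖) {ε : ℝ} (hε : ε ≤ 1) {u u' : E₁}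
    {b b' : E₂} (hu : ‖u‖ ≤ 1) (hb : ‖b‖ ≤ 1) (huu : ‖u - u'‖ ≤ ε) (hbb : ‖b - b'‖ ≤ ε) :
    ‖q u b - q u' b'‖ ≤ 3 * ε * Q := by
  have hε0 : 0 ≤ ε := (norm_nonneg _).trans huu
  have hu' : ‖u'‖ ≤ 2 := by
    have := norm_sub_norm_le u' u
    rw [norm_sub_rev] at this
    linarith
  have h : q u b - q u' b' = q (u - u') b + q u' (b - b') := by
    simp only [map_sub, LinearMap.sub_apply]; abel
  rw [h]
  refine (norm_add_le _ _).trans ?_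
  calc _ ≤ Q * ‖u - u'‖ * ‖b‖ + Q * ‖u'‖ * ‖b - b'‖ := add_le_add (hq _ _) (hq _ _)
    _ ≤ Q * ε * 1 + Q * 2 * ε := by gcongr
    _ = _ := by ring

variable [FiniteDimensional ℝ E₁] [FiniteDimensional ℝ E₂]

theorem exists_bilin_bound (q : E₁ →ₗ[ℝ] E₂ →ₗ[ℝ] G) :
    ∃ Q : ℝ, 0 ≤ Q ∧ (∀ u b, ‖q u b‖ ≤ Q * ‖u‖ * ‖b‖) ∧
      ∀ K, 0 ≤ K → (∀ u b, ‖u‖ ≤ 1 → ‖b‖ ≤ 1 → ‖q u b‖ ≤ K) → Q ≤ K := by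
  let q' : E₁ →L[ℝ] E₂ →L[ℝ] G := LinearMap.toContinuousLinearMap
    ((LinearMap.toContinuousLinearMap : (E₂ →ₗ[ℝ] G) ≃ₗ[ℝ] E₂ →L[ℝ] G).toLinearMap ∘ₗ q)
  have hq' : ∀ u b, q' u b = q u b := fun u b => rfl
  refine ⟨‖q'‖, norm_nonneg q', fun u b => by rw [← hq']; exact q'.le_opNorm₂ u b, ?_⟩
  intro K hK h
  refine ContinuousLinearMap.opNorm_le_of_unit_norm hK fun u hu =>
    ContinuousLinearMap.opNorm_le_of_unit_norm hK fun b hb => ?_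
  rw [hq']
  exact h u b hu.le hb.le

theorem norm_map_bilin_of_net {p : E₁ →ₗ[ℝ] E₂ →ₗ[ℝ] F} (hp : ∀ u b, ‖p u b‖ ≤ ‖u‖ * ‖b‖)
    (L : F →ₗ[ℝ] G) {N₁ : Finset E₁} {N₂ : Finset E₂} {δ ε : ℝ} (hδ0 : 0 < δ) (hδ1 : δ ≤ 1)
    (hε : ε ≤ δ / 300)
    (hN₁ : ∀ u : E₁, ‖u‖ ≤ 1 → ∃ u' ∈ N₁, ‖u - u'‖ ≤ ε)
    (hN₂ : ∀ b : E₂, ‖b‖ ≤ 1 → ∃ b' ∈ N₂, ‖b - b'‖ ≤ ε)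
    (hL : ∀ u ∈ N₁, ∀ b ∈ N₂, (1 - δ / 4) * ‖p u b‖ ^ 2 ≤ ‖L (p u b)‖ ^ 2 ∧
      ‖L (p u b)‖ ^ 2 ≤ (1 + δ / 4) * ‖p u b‖ ^ 2)
    {u : E₁} {b : E₂} (hu : ‖u‖ ≤ 1) (hb : ‖b‖ ≤ ‖p u b‖) :
    (1 - δ) * ‖p u b‖ ^ 2 ≤ ‖L (p u b)‖ ^ 2 ∧ ‖L (p u b)‖ ^ 2 ≤ (1 + δ) * ‖p u b‖ ^ 2 := by
  have hL' : ∀ u ∈ N₁, ∀ b ∈ N₂, (1 - δ / 4) * ‖p u b‖ ≤ ‖L (p u b)‖ ∧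
      ‖L (p u b)‖ ≤ (1 + δ / 8) * ‖p u b‖ := by
    intro u hu b hb
    obtain ⟨h1, h2⟩ := hL u hu b hb
    constructor
    · refine le_of_sq_le_sq ?_ (norm_nonneg _)
      refine le_trans ?_ h1
      rw [mul_pow]
      gcongr
      nlinarith
    · refine le_of_sq_le_sq (h2.trans ?_) (by positivity)
      rw [mul_pow]
      gcongr
      nlinarith
  obtain ⟨Q, hQ0, hQ, hQmin⟩ := exists_bilin_bound (p.compr₂ L)
  have hε0 : 0 ≤ ε := by
    obtain ⟨u', -, h⟩ := hN₁ 0 (by simp)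
    exact (norm_nonneg _).trans h
  have approx : ∀ u b, ‖u‖ ≤ 1 → ‖b‖ ≤ 1 → ∃ u' ∈ N₁, ∃ b' ∈ N₂,
      ‖p u b - p u' b'‖ ≤ δ / 100 ∧ ‖L (p u b) - L (p u' b')‖ ≤ δ / 100 * Q := by
    intro u b hu hb
    obtain ⟨u', hu', huu⟩ := hN₁ u hu
    obtain ⟨b', hb', hbb⟩ := hN₂ b hb
    refine ⟨u', hu', b', hb', ?_, ?_⟩
    · refine (norm_sub_bilin_le zero_le_one (by simp [hp]) (by linarith) hu hb huu
        hbb).trans (by linarith)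
    · refine (norm_sub_bilin_le (q := p.compr₂ L) hQ0 hQ (by linarith) hu hb huu hbb).trans ?_
      gcongr
      linarith
  have hQle : Q ≤ 1 + δ / 5 := by
    have : Q ≤ (1 + δ / 8) * (1 + δ / 100) + δ / 100 * Q := by
      refine hQmin _ (by positivity) fun u b hu hb => ?_
      obtain ⟨u', hu', b', hb', h1, h2⟩ := approx u b hu hb
      have h3 := (hL' u' hu' b' hb').2
      have h4 : ‖p u' b'‖ ≤ 1 + δ / 100 := by
        have h5 := norm_sub_norm_le (p u' b') (p u b)
        rw [norm_sub_rev] at h5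
        have h6 : ‖u‖ * ‖b‖ ≤ 1 := mul_le_one₀ hu (norm_nonneg _) hb
        linarith [hp u b]
      have h7 := norm_sub_norm_le (L (p u b)) (L (p u' b'))
      have h8 : (1 + δ / 8) * ‖p u' b'‖ ≤ (1 + δ / 8) * (1 + δ / 100) := by gcongr
      rw [LinearMap.compr₂_apply]
      linarith
    nlinarith
  have unit : ∀ u b, ‖u‖ ≤ 1 → ‖b‖ ≤ 1 → ‖p u b‖ = 1 →
      1 - δ / 2 ≤ ‖L (p u b)‖ ∧ ‖L (p u b)‖ ≤ 1 + δ / 5 := by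
    intro u b hu hb h1
    constructor
    · obtain ⟨u', hu', b', hb', h2, h3⟩ := approx u b hu hb
      have h4 := (hL' u' hu' b' hb').1
      have h5 := norm_sub_norm_le (p u b) (p u' b')
      have h6 := norm_sub_norm_le (L (p u' b')) (L (p u b))
      rw [norm_sub_rev] at h6
      have h7 : (1 - δ / 4) * (1 - δ / 100) ≤ (1 - δ / 4) * ‖p u' b'‖ := by
        gcongr <;> linarith
      nlinarith
    · have h2 := hQ u b
      rw [LinearMap.compr₂_apply] at h2
      have : Q * ‖u‖ * ‖b‖ ≤ Q * 1 * 1 := by gcongr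
      linarith
  rcases eq_or_ne (p u b) 0 with h0 | h0
  · simp [h0]
  have hpos : 0 < ‖p u b‖ := norm_pos_iff.2 h0
  obtain ⟨h1, h2⟩ := unit u (‖p u b‖⁻¹ • b) hu
    (by rw [norm_smul, norm_inv, norm_norm]; rw [inv_mul_le_iff₀ hpos]; linarith)
    (by rw [map_smul, norm_smul, norm_inv, norm_norm]; field_simp)
  rw [map_smul, map_smul, norm_smul, norm_inv, norm_norm] at h1 h2
  rw [le_inv_mul_iff₀ hpos] at h1
  rw [inv_mul_le_iff₀ hpos] at h2
  constructor
  · calc _ ≤ (‖p u b‖ * (1 - δ / 2)) ^ 2 := by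
          rw [mul_pow, mul_comm]; gcongr; nlinarith
      _ ≤ _ := by gcongr; nlinarith
  · calc _ ≤ (‖p u b‖ * (1 + δ / 5)) ^ 2 := by gcongr
      _ ≤ _ := by rw [mul_pow, mul_comm]; gcongr; nlinarith

end

theorem exists_factor_of_finrank_span_le {ι E : Type*} [NormedAddCommGroup E]
    [InnerProductSpace ℝ E] [FiniteDimensional ℝ E] {r : ℕ} (f : ι → E)
    (hr : Module.finrank ℝ (Submodule.span ℝ (Set.range f)) ≤ r) :
    ∃ u : EuclideanSpace ℝ (Fin r) →L[ℝ] E, ‖u‖ ≤ 1 ∧ ∃ b : ι → EuclideanSpace ℝ (Fin r),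
      ∀ j, u (b j) = f j ∧ ‖b j‖ = ‖f j‖ := by
  set K := Submodule.span ℝ (Set.range f) with hK
  let v := stdOrthonormalBasis ℝ K
  let w : Fin (Module.finrank ℝ K) → EuclideanSpace ℝ (Fin r) :=
    EuclideanSpace.basisFun (Fin r) ℝ ∘ Fin.castLE hr
  have hw : Orthonormal ℝ w :=
    (EuclideanSpace.basisFun (Fin r) ℝ).orthonormal.comp _ (Fin.castLE_injective hr)
  let J : K →ₗᵢ[ℝ] EuclideanSpace ℝ (Fin r) :=
    (v.toBasis.constr ℝ w).isometryOfOrthonormal (v := v.toBasis) (by simp)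
      (by convert hw using 1; ext1 i; simp only [Function.comp_apply, Module.Basis.constr_basis])
  let Jc : K →L[ℝ] EuclideanSpace ℝ (Fin r) := J.toContinuousLinearMap
  have hfK : ∀ j, f j ∈ K := fun j => Submodule.subset_span ⟨j, rfl⟩
  refine ⟨K.subtypeL ∘L ContinuousLinearMap.adjoint Jc, ?_, fun j => J ⟨f j, hfK j⟩, fun j =>
    ⟨?_, ?_⟩⟩
  · refine (ContinuousLinearMap.opNorm_comp_le _ _).trans ?_
    refine mul_le_one₀ (Submodule.norm_subtypeL_le K) (norm_nonneg _) ?_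
    rw [LinearIsometryEquiv.norm_map]
    exact J.norm_toContinuousLinearMap_le
  · have h : ContinuousLinearMap.adjoint Jc (Jc ⟨f j, hfK j⟩) = ⟨f j, hfK j⟩ := by
      refine ext_inner_right ℝ fun y => ?_
      rw [ContinuousLinearMap.adjoint_inner_left]
      exact J.inner_map_map _ _
    exact congrArg Subtype.val h
  · rw [J.norm_map]; rfl

/-- Applying a linear map to each row of an `s`-tuple of vectors, as a bilinear map. -/
noncomputable def mapRows (r s : ℕ) :
    (EuclideanSpace ℝ (Fin r) →L[ℝ] EuclideanSpace ℝ (Fin s)) →ₗ[ℝ]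
      PiLp 2 (fun _ : Fin s => EuclideanSpace ℝ (Fin r)) →ₗ[ℝ]
        PiLp 2 (fun _ : Fin s => EuclideanSpace ℝ (Fin s)) :=
  LinearMap.mk₂ ℝ (fun u b => WithLp.toLp 2 fun j => u (b j))
    (fun u u' b => by ext; simp) (fun c u b => by ext; simp)
    (fun u b b' => by ext; simp) (fun c u b => by ext; simp)

theorem mapRows_apply {r s : ℕ} (u : EuclideanSpace ℝ (Fin r) →L[ℝ] EuclideanSpace ℝ (Fin s))
    (b : PiLp 2 (fun _ : Fin s => EuclideanSpace ℝ (Fin r))) (j : Fin s) :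
    mapRows r s u b j = u (b j) := rfl

theorem norm_mapRows_le {r s : ℕ} (u : EuclideanSpace ℝ (Fin r) →L[ℝ] EuclideanSpace ℝ (Fin s))
    (b : PiLp 2 (fun _ : Fin s => EuclideanSpace ℝ (Fin r))) :
    ‖mapRows r s u b‖ ≤ ‖u‖ * ‖b‖ := by
  refine le_of_sq_le_sq ?_ (by positivity)
  rw [mul_pow, PiLp.norm_sq_eq_of_L2, PiLp.norm_sq_eq_of_L2, Finset.mul_sum]
  refine Finset.sum_le_sum fun j _ => ?_
  rw [mapRows_apply, ← mul_pow]
  gcongr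
  exact u.le_opNorm _

theorem norm_sq_rows {s : ℕ} (w : PiLp 2 (fun _ : Fin s => EuclideanSpace ℝ (Fin s))) :
    ‖w‖ ^ 2 = ∑ a, ∑ b, w a b ^ 2 := by
  rw [PiLp.norm_sq_eq_of_L2]
  refine Finset.sum_congr rfl fun a _ => ?_
  rw [EuclideanSpace.norm_sq_eq]
  simp

/-- The measurement map given by the submatrices of `A 0, …, A (m - 1)` indexed by `e`. -/
noncomputable def sampling {n m s : ℕ} (A : Fin m → Fin n → Fin n → ℝ) (e : Fin s → Fin n) :
    PiLp 2 (fun _ : Fin s => EuclideanSpace ℝ (Fin s)) →ₗ[ℝ] EuclideanSpace ℝ (Fin m) where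
  toFun w := WithLp.toLp 2 fun k => ∑ a, ∑ b, w a b * A k (e a) (e b)
  map_add' w w' := by ext k; simp [add_mul, Finset.sum_add_distrib]
  map_smul' c w := by ext k; simp [mul_assoc, Finset.mul_sum]

theorem norm_sq_sampling {n m s : ℕ} (A : Fin m → Fin n → Fin n → ℝ) (e : Fin s → Fin n)
    (w : PiLp 2 (fun _ : Fin s => EuclideanSpace ℝ (Fin s))) :
    ‖sampling A e w‖ ^ 2 = ∑ k, (∑ a, ∑ b, w a b * A k (e a) (e b)) ^ 2 := by
  rw [EuclideanSpace.norm_sq_eq]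
  simp [sampling]

theorem exists_sampling_concentration {t : ℝ} (ht : 0 < t) (ht1 : t < 1) :
    ∃ c : ℝ, 0 < c ∧ ∀ {n m s : ℕ} {e : Fin s → Fin n}, 0 < m → e.Injective →
      ∀ w : PiLp 2 (fun _ : Fin s => EuclideanSpace ℝ (Fin s)),
      (Measure.pi fun _ : Fin m => Measure.pi fun _ : Fin n =>
            Measure.pi fun _ : Fin n => gaussianReal 0 (1 / (m : ℝ≥0))).real
        {A | ¬ ((1 - t) * ‖w‖ ^ 2 ≤ ‖sampling A e w‖ ^ 2 ∧
          ‖sampling A e w‖ ^ 2 ≤ (1 + t) * ‖w‖ ^ 2)} ≤ 2 * Real.exp (-c * m) := by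
  obtain ⟨c₁, hc₁, h₁⟩ := exists_chi_sq_upper_tail ht
  obtain ⟨c₂, hc₂, h₂⟩ := exists_chi_sq_lower_tail ht ht1
  refine ⟨min c₁ c₂, lt_min hc₁ hc₂, ?_⟩
  intro n m s e hm he w
  set ν := Measure.pi fun _ : Fin n => Measure.pi fun _ : Fin n =>
    gaussianReal 0 (1 / (m : ℝ≥0)) with hν
  rcases eq_or_ne w 0 with rfl | hw
  · simp [Real.exp_nonneg]
  set v : ℝ≥0 := (∑ a, ∑ b, ‖w a b‖₊ ^ 2) * (1 / m) with hv
  have hm0 : (m : ℝ) ≠ 0 := by positivity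
  have hvw : (m : ℝ) * v = ‖w‖ ^ 2 := by
    rw [hv, norm_sq_rows]
    push_cast
    simp only [Real.norm_eq_abs, sq_abs]
    field_simp
  have hv0 : v ≠ 0 := by
    rintro h
    rw [h, NNReal.coe_zero, mul_zero] at hvw
    exact hw (norm_eq_zero.1 (pow_eq_zero_iff two_ne_zero |>.1 hvw.symm))
  have hmeas : Measurable fun x : Fin n → Fin n → ℝ => ∑ a, ∑ b, w a b * x (e a) (e b) := by
    fun_prop
  have hX : ∀ k : Fin m, Measurable fun A : Fin m → Fin n → Fin n → ℝ =>
      ∑ a, ∑ b, w a b * A k (e a) (e b) := fun k => hmeas.comp (measurable_pi_apply k)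
  have hind : iIndepFun (fun (k : Fin m) (A : Fin m → Fin n → Fin n → ℝ) =>
      ∑ a, ∑ b, w a b * A k (e a) (e b)) (Measure.pi fun _ => ν) :=
    iIndepFun_pi fun _ => hmeas.aemeasurable
  have hlaw : ∀ k : Fin m, (Measure.pi fun _ : Fin m => ν).map
      (fun A => ∑ a, ∑ b, w a b * A k (e a) (e b)) = gaussianReal 0 v := by
    intro k
    rw [hv, ← map_bilin_pi_pi_eq_gaussianReal he (1 / (m : ℝ≥0)) fun a b => w a b, ← hν]
    conv_rhs => rw [← (measurePreserving_eval (fun _ : Fin m => ν) k).map_eq,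
      Measure.map_map hmeas (measurable_pi_apply k)]
    rfl
  have g₁ := h₁ hX hind hlaw hv0
  have g₂ := h₂ hX hind hlaw hv0
  simp_rw [hvw, ← norm_sq_sampling] at g₁ g₂
  refine (measureReal_mono (s₂ := {A | (1 + t) * ‖w‖ ^ 2 ≤ ‖sampling A e w‖ ^ 2} ∪
    {A | ‖sampling A e w‖ ^ 2 ≤ (1 - t) * ‖w‖ ^ 2}) ?_).trans
    ((measureReal_union_le _ _).trans ?_)
  · intro A hA
    rw [Set.mem_ofPred_eq, not_and_or, not_le, not_le] at hA
    exact hA.symm.imp le_of_lt le_of_lt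
  · have e₁ : Real.exp (-c₁ * m) ≤ Real.exp (-min c₁ c₂ * m) := by
      gcongr; exact min_le_left _ _
    have e₂ : Real.exp (-c₂ * m) ≤ Real.exp (-min c₁ c₂ * m) := by
      gcongr; exact min_le_right _ _
    linarith

theorem exists_mapRows_eq {n r s : ℕ} {Z : Matrix (Fin n) (Fin n) ℝ} (hZ : Z.rank ≤ r)
    (e : Fin s → Fin n) :
    ∃ u : EuclideanSpace ℝ (Fin r) →L[ℝ] EuclideanSpace ℝ (Fin s), ‖u‖ ≤ 1 ∧
      ∃ b : PiLp 2 (fun _ : Fin s => EuclideanSpace ℝ (Fin r)), ‖b‖ ≤ ‖mapRows r s u b‖ ∧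
        ∀ i j, mapRows r s u b i j = Z (e i) (e j) := by
  let R : (Fin n → ℝ) →ₗ[ℝ] EuclideanSpace ℝ (Fin s) :=
    (WithLp.linearEquiv 2 ℝ (Fin s → ℝ)).symm.toLinearMap ∘ₗ LinearMap.funLeft ℝ ℝ e
  have hspan : Submodule.span ℝ (Set.range fun i => R (Z (e i))) ≤
      (Submodule.span ℝ (Set.range Z.row)).map R := by
    rw [Submodule.span_le]
    rintro _ ⟨i, rfl⟩
    exact Submodule.mem_map_of_mem (Submodule.subset_span ⟨e i, rfl⟩)
  have hr : Module.finrank ℝ (Submodule.span ℝ (Set.range fun i => R (Z (e i)))) ≤ r :=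
    (Submodule.finrank_mono hspan).trans ((Submodule.finrank_map_le _ _).trans
      (Z.rank_eq_finrank_span_row ▸ hZ))
  obtain ⟨u, hu, b, hb⟩ := exists_factor_of_finrank_span_le _ hr
  refine ⟨u, hu, WithLp.toLp 2 b, ?_, fun i j => ?_⟩
  · refine le_of_sq_le_sq (le_of_eq ?_) (norm_nonneg _)
    rw [PiLp.norm_sq_eq_of_L2, PiLp.norm_sq_eq_of_L2]
    refine Finset.sum_congr rfl fun j _ => ?_
    rw [mapRows_apply]
    change ‖b j‖ ^ 2 = ‖u (b j)‖ ^ 2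
    rw [(hb j).1, (hb j).2]
  · rw [mapRows_apply]
    change u (b i) j = _
    rw [(hb i).1]
    rfl

theorem sum_sum_eq_of_support {n s : ℕ} {e : Fin s → Fin n} (he : e.Injective)
    {g : Fin n → Fin n → ℝ} (hg : ∀ i j, ¬ (i ∈ Set.range e ∧ j ∈ Set.range e) → g i j = 0) :
    ∑ i, ∑ j, g i j = ∑ a, ∑ b, g (e a) (e b) := by
  symm
  refine Fintype.sum_of_injective e he _ _ (fun i hi => ?_) fun a => ?_
  · exact Finset.sum_eq_zero fun j _ => hg i j fun h => hi h.1
  · exact Fintype.sum_of_injective e he _ _ (fun j hj => hg _ j fun h => hj h.2) fun b => rfl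

theorem finrank_clm_euclideanSpace (r s : ℕ) :
    Module.finrank ℝ (EuclideanSpace ℝ (Fin r) →L[ℝ] EuclideanSpace ℝ (Fin s)) = r * s := by
  rw [← LinearEquiv.finrank_eq (LinearMap.toContinuousLinearMap :
    (EuclideanSpace ℝ (Fin r) →ₗ[ℝ] EuclideanSpace ℝ (Fin s)) ≃ₗ[ℝ] _), Module.finrank_linearMap]
  simp

theorem finrank_piLp_euclideanSpace (r s : ℕ) :
    Module.finrank ℝ (PiLp 2 (fun _ : Fin s => EuclideanSpace ℝ (Fin r))) = r * s := by
  rw [LinearEquiv.finrank_eq (WithLp.linearEquiv 2 ℝ (Fin s → EuclideanSpace ℝ (Fin r))),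
    Module.finrank_pi_fintype]
  simp [mul_comm]

theorem choose_le_exp_mul_log {n s : ℕ} (hs : 0 < s) (hsn : s ≤ n) :
    (n.choose s : ℝ) ≤ Real.exp (s * Real.log (Real.exp 1 * n / s)) := by
  have hs' : (0 : ℝ) < s := by positivity
  have hn' : (0 : ℝ) < n := by exact_mod_cast hs.trans_le hsn
  rw [Real.exp_nat_mul, Real.exp_log (by positivity)]
  refine (Nat.choose_le_pow_div s n).trans ?_
  have h := Real.pow_div_factorial_le_exp (s : ℝ) hs'.le s
  rw [div_pow, mul_pow, ← Real.exp_nat_mul, mul_one, le_div_iff₀ (by positivity)]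
  calc (n : ℝ) ^ s / s.factorial * s ^ s = (s : ℝ) ^ s / s.factorial * n ^ s := by ring
    _ ≤ _ := by gcongr

theorem one_le_log_exp_mul_div {n s : ℕ} (hs : 0 < s) (hsn : s ≤ n) :
    1 ≤ Real.log (Real.exp 1 * n / s) := by
  have hs' : (0 : ℝ) < s := by positivity
  have hsn' : (s : ℝ) ≤ n := by exact_mod_cast hsn
  have hn' : (0 : ℝ) < n := hs'.trans_le hsn'
  rw [Real.le_log_iff_exp_le (by positivity), le_div_iff₀ hs']
  gcongr

theorem exists_family_of_nets (k r s n : ℕ) (hr : 0 < r) (hs : 0 < s) (hsn : s ≤ n) :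
    ∃ (N₁ : Finset (EuclideanSpace ℝ (Fin r) →L[ℝ] EuclideanSpace ℝ (Fin s)))
      (N₂ : Finset (PiLp 2 (fun _ : Fin s => EuclideanSpace ℝ (Fin r)))),
      (∀ u, ‖u‖ ≤ 1 → ∃ u' ∈ N₁, ‖u - u'‖ ≤ (1 / 2) ^ k) ∧
      (∀ b, ‖b‖ ≤ 1 → ∃ b' ∈ N₂, ‖b - b'‖ ≤ (1 / 2) ^ k) ∧
      (n.choose s : ℝ) * (N₁.card * N₂.card) ≤
        Real.exp ((2 * k * Real.log 5 + 1) * (r * s * Real.log (Real.exp 1 * n / s))) := by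
  obtain ⟨N₁, hN₁, h₁⟩ :=
    exists_finset_net (EuclideanSpace ℝ (Fin r) →L[ℝ] EuclideanSpace ℝ (Fin s)) k
  obtain ⟨N₂, hN₂, h₂⟩ :=
    exists_finset_net (PiLp 2 (fun _ : Fin s => EuclideanSpace ℝ (Fin r))) k
  refine ⟨N₁, N₂, h₁, h₂, ?_⟩
  rw [finrank_clm_euclideanSpace] at hN₁
  rw [finrank_piLp_euclideanSpace] at hN₂
  have hpow : ((5 : ℝ) ^ (r * s * k)) = Real.exp (r * s * k * Real.log 5) := by
    rw [← Real.exp_log (show (0 : ℝ) < 5 by norm_num), ← Real.exp_nat_mul, Real.log_exp]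
    push_cast
    rfl
  have hN₁' : (N₁.card : ℝ) ≤ Real.exp (r * s * k * Real.log 5) := by
    rw [← hpow]; exact_mod_cast hN₁
  have hN₂' : (N₂.card : ℝ) ≤ Real.exp (r * s * k * Real.log 5) := by
    rw [← hpow]; exact_mod_cast hN₂
  set ℓ := Real.log (Real.exp 1 * n / s) with hℓ
  have hℓ1 : 1 ≤ ℓ := one_le_log_exp_mul_div hs hsn
  have hr' : (1 : ℝ) ≤ r := by exact_mod_cast hr
  have hlog5 : 0 ≤ Real.log 5 := Real.log_nonneg (by norm_num)
  calc (n.choose s : ℝ) * (N₁.card * N₂.card)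
      ≤ Real.exp (s * ℓ) * (Real.exp (r * s * k * Real.log 5) *
          Real.exp (r * s * k * Real.log 5)) := by
        gcongr
        exact choose_le_exp_mul_log hs hsn
    _ = Real.exp (s * ℓ * 1 + 2 * k * Real.log 5 * (r * s) * 1) := by
        rw [← Real.exp_add, ← Real.exp_add]; congr 1; ring
    _ ≤ Real.exp (s * ℓ * r + 2 * k * Real.log 5 * (r * s) * ℓ) := by gcongr
    _ = _ := by congr 1; ring

theorem frobNorm_sq_and_frobInner_of_restr {n s : ℕ} {e : Fin s → Fin n} (he : e.Injective)
    {S : Finset (Fin n)} (hS : ∀ i, i ∈ S ↔ i ∈ Set.range e)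
    {Z : Matrix (Fin n) (Fin n) ℝ} (hZ : Z = restr Z S S)
    {w : PiLp 2 (fun _ : Fin s => EuclideanSpace ℝ (Fin s))}
    (hw : ∀ i j, w i j = Z (e i) (e j)) {m : ℕ} (A : Fin m → Fin n → Fin n → ℝ) :
    frobNorm Z ^ 2 = ‖w‖ ^ 2 ∧
      ∑ i, (frobInner Z (Matrix.of (A i))) ^ 2 = ‖sampling A e w‖ ^ 2 := by
  have h0 : ∀ i j, ¬ (i ∈ Set.range e ∧ j ∈ Set.range e) → Z i j = 0 := by
    intro i j hij
    rw [← hS, ← hS] at hij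
    rw [hZ, restr, Matrix.of_apply, if_neg hij]
  constructor
  · rw [frobNorm, Real.sq_sqrt (by positivity), norm_sq_rows,
      sum_sum_eq_of_support he fun i j hij => by rw [h0 i j hij]; simp]
    simp_rw [hw]
  · rw [norm_sq_sampling]
    refine Finset.sum_congr rfl fun k _ => ?_
    rw [frobInner, sum_sum_eq_of_support he fun i j hij => by rw [h0 i j hij, zero_mul]]
    simp_rw [hw, Matrix.of_apply]

/-- RIP for i.i.d. Gaussian measurement matrices. -/
theorem stmt0 (δ : ℝ) (hδ : 0 < δ) :
    ∃ C c : ℝ, 0 < C ∧ 0 < c ∧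
      ∀ n m r s : ℕ, 0 < n → 0 < m → 0 < r → 0 < s → s ≤ n →
        (m : ℝ) ≥ C * r * s * Real.log (Real.exp 1 * n / s) →
        (Measure.pi fun _ : Fin m => Measure.pi fun _ : Fin n =>
            Measure.pi fun _ : Fin n => ProbabilityTheory.gaussianReal 0 (1 / (m : ℝ≥0)))
          {A : Fin m → Fin n → Fin n → ℝ |
            ∀ Z ∈ SigmaRS n r s,
              (1 - δ) * frobNorm Z ^ 2 ≤ ∑ i, (frobInner Z (Matrix.of (A i))) ^ 2 ∧
              ∑ i, (frobInner Z (Matrix.of (A i))) ^ 2 ≤ (1 + δ) * frobNorm Z ^ 2} ≥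
          ENNReal.ofReal (1 - 2 * Real.exp (-c * m)) := by
  set d := min δ 1 with hd
  have hd0 : 0 < d := lt_min hδ one_pos
  have hd1 : d ≤ 1 := min_le_right _ _
  have hdδ : d ≤ δ := min_le_left _ _
  obtain ⟨c, hc, hconc⟩ := exists_sampling_concentration (t := d / 4) (by positivity)
    (by linarith)
  obtain ⟨k, hk⟩ := exists_pow_lt_of_lt_one (show 0 < d / 300 by positivity)
    (show (1 / 2 : ℝ) < 1 by norm_num)
  set K := 2 * k * Real.log 5 + 1 with hK
  have hlog5 : 0 ≤ Real.log 5 := Real.log_nonneg (by norm_num)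
  have hK0 : 0 < K := by positivity
  refine ⟨2 * K / c, c / 2, by positivity, by positivity, ?_⟩
  intro n m r s _ hm hr hs hsn hmC
  set μ := Measure.pi fun _ : Fin m => Measure.pi fun _ : Fin n =>
    Measure.pi fun _ : Fin n => gaussianReal 0 (1 / (m : ℝ≥0)) with hμ
  obtain ⟨N₁, N₂, hN₁, hN₂, hcard⟩ := exists_family_of_nets k r s n hr hs hsn
  let emb : (powersetCard s (univ : Finset (Fin n))) → Fin s → Fin n := fun S =>
    S.1.orderEmbOfFin (mem_powersetCard.1 S.2).2
  have hemb : ∀ S, (emb S).Injective := fun S => (S.1.orderEmbOfFin _).injective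
  let T := (univ : Finset (powersetCard s (univ : Finset (Fin n)))) ×ˢ (N₁ ×ˢ N₂)
  let bad : powersetCard s (univ : Finset (Fin n)) ×
      ((EuclideanSpace ℝ (Fin r) →L[ℝ] EuclideanSpace ℝ (Fin s)) ×
      PiLp 2 (fun _ : Fin s => EuclideanSpace ℝ (Fin r))) →
      Set (Fin m → Fin n → Fin n → ℝ) := fun x =>
    {A | ¬ ((1 - d / 4) * ‖mapRows r s x.2.1 x.2.2‖ ^ 2 ≤
        ‖sampling A (emb x.1) (mapRows r s x.2.1 x.2.2)‖ ^ 2 ∧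
      ‖sampling A (emb x.1) (mapRows r s x.2.1 x.2.2)‖ ^ 2 ≤
        (1 + d / 4) * ‖mapRows r s x.2.1 x.2.2‖ ^ 2)}
  have hbad : μ.real (⋃ x ∈ T, bad x) ≤ 2 * Real.exp (-(c / 2) * m) := by
    have hT : (T.card : ℝ) ≤ Real.exp (c / 2 * m) := by
      have h1 : (T.card : ℝ) = n.choose s * (N₁.card * N₂.card) := by
        simp [T, card_product]
      rw [h1]
      refine hcard.trans (Real.exp_le_exp.2 ?_)
      have h2 : 2 * K / c * r * s * Real.log (Real.exp 1 * n / s) =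
          K * (r * s * Real.log (Real.exp 1 * n / s)) / (c / 2) := by field_simp
      rw [ge_iff_le, h2, div_le_iff₀ (by positivity)] at hmC
      linarith
    calc μ.real (⋃ x ∈ T, bad x) ≤ ∑ x ∈ T, μ.real (bad x) := measureReal_biUnion_finset_le _ _
      _ ≤ ∑ x ∈ T, 2 * Real.exp (-c * m) :=
          Finset.sum_le_sum fun x _ => hconc hm (hemb x.1) _
      _ = T.card * (2 * Real.exp (-c * m)) := by rw [sum_const, nsmul_eq_mul]
      _ ≤ Real.exp (c / 2 * m) * (2 * Real.exp (-c * m)) := by gcongr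
      _ = 2 * Real.exp (-(c / 2) * m) := by
          rw [mul_left_comm, ← Real.exp_add]; congr 2; ring
  have hsub : (⋃ x ∈ T, bad x)ᶜ ⊆ {A : Fin m → Fin n → Fin n → ℝ |
      ∀ Z ∈ SigmaRS n r s,
        (1 - δ) * frobNorm Z ^ 2 ≤ ∑ i, (frobInner Z (Matrix.of (A i))) ^ 2 ∧
        ∑ i, (frobInner Z (Matrix.of (A i))) ^ 2 ≤ (1 + δ) * frobNorm Z ^ 2} := by
    rintro A hA Z ⟨-, hrank, S, hS, hZ⟩
    let S' : powersetCard s (univ : Finset (Fin n)) :=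
      ⟨S, mem_powersetCard.2 ⟨subset_univ _, hS⟩⟩
    obtain ⟨u, hu, b, hb, hub⟩ := exists_mapRows_eq hrank (emb S')
    obtain ⟨h1, h2⟩ := frobNorm_sq_and_frobInner_of_restr (hemb S') (S := S)
      (fun i => by rw [Finset.range_orderEmbOfFin]; rfl) hZ hub A
    rw [h1, h2]
    have hnet : ∀ u ∈ N₁, ∀ b ∈ N₂,
        (1 - d / 4) * ‖mapRows r s u b‖ ^ 2 ≤ ‖sampling A (emb S') (mapRows r s u b)‖ ^ 2 ∧
        ‖sampling A (emb S') (mapRows r s u b)‖ ^ 2 ≤ (1 + d / 4) * ‖mapRows r s u b‖ ^ 2 := by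
      intro u hu b hb
      by_contra hcon
      exact hA (Set.mem_biUnion (x := (S', u, b)) (by simp [T, hu, hb]) hcon)
    obtain ⟨h3, h4⟩ := norm_map_bilin_of_net norm_mapRows_le (sampling A (emb S')) hd0 hd1 hk.le
      hN₁ hN₂ hnet hu hb
    constructor
    · refine le_trans ?_ h3; gcongr
    · refine h4.trans ?_; gcongr
  have hone : 1 ≤ μ.real (⋃ x ∈ T, bad x) + μ.real (⋃ x ∈ T, bad x)ᶜ := by
    have := measureReal_union_le (μ := μ) (⋃ x ∈ T, bad x) (⋃ x ∈ T, bad x)ᶜ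
    rwa [Set.union_compl_self, probReal_univ] at this
  refine le_trans ?_ (measure_mono hsub)
  rw [← ofReal_measureReal]
  exact ENNReal.ofReal_le_ofReal (by linarith)
end

section
/- Let M be a symmetric real n×n matrix and let s ≤ n. Let S⋆ be an index set of cardinality s such that ‖M − M_{:×S⋆}‖_F ≤ ‖M − M_{:×S}‖_F for every index set S of cardinality s (i.e., S⋆ indexes s columns of M of largest ℓ₂-norms). Then ‖M − M_{S⋆×S⋆}‖_F ≤ √2 · ‖M − M_{S×S}‖_F for every index set S of cardinality s. -/
open Matrix Finset MeasureTheory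
open scoped ENNReal NNReal

theorem frobNorm_sub_restr {n : ℕ} (M : Matrix (Fin n) (Fin n) ℝ) (S T : Finset (Fin n)) :
    frobNorm (M - restr M S T) =
      Real.sqrt (∑ i, ∑ j, if i ∈ S ∧ j ∈ T then 0 else M i j ^ 2) := by
  unfold frobNorm
  congr 1
  refine Finset.sum_congr rfl fun i _ => Finset.sum_congr rfl fun j _ => ?_
  by_cases h : i ∈ S ∧ j ∈ T <;> simp [restr, h]

theorem frobNorm_sub_restr_univ_le {n : ℕ} (M : Matrix (Fin n) (Fin n) ℝ)
    (S T : Finset (Fin n)) :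
    frobNorm (M - restr M Finset.univ T) ≤ frobNorm (M - restr M S T) := by
  rw [frobNorm_sub_restr, frobNorm_sub_restr]
  refine Real.sqrt_le_sqrt (Finset.sum_le_sum fun i _ => Finset.sum_le_sum fun j _ => ?_)
  have := sq_nonneg (M i j)
  by_cases hi : i ∈ S <;> by_cases hj : j ∈ T <;> simp [hi, hj, this]

/-- For symmetric `M`, the tail of a principal block is controlled by that of its columns. -/
theorem frobNorm_sub_restr_self_le {n : ℕ} {M : Matrix (Fin n) (Fin n) ℝ} (hM : M.IsSymm)
    (S : Finset (Fin n)) :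
    frobNorm (M - restr M S S) ≤ Real.sqrt 2 * frobNorm (M - restr M Finset.univ S) := by
  rw [frobNorm_sub_restr, frobNorm_sub_restr, ← Real.sqrt_mul zero_le_two]
  apply Real.sqrt_le_sqrt
  have hrow : (∑ i, ∑ j, if i ∈ S then 0 else M i j ^ 2) =
      ∑ i, ∑ j, if i ∈ Finset.univ ∧ j ∈ S then 0 else M i j ^ 2 := by
    rw [Finset.sum_comm]
    refine Finset.sum_congr rfl fun i _ => Finset.sum_congr rfl fun j _ => ?_
    simp [hM.apply i j]
  rw [two_mul]
  nth_rewrite 1 [← hrow]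
  simp only [← Finset.sum_add_distrib]
  refine Finset.sum_le_sum fun i _ => Finset.sum_le_sum fun j _ => ?_
  have := sq_nonneg (M i j)
  by_cases hi : i ∈ S <;> by_cases hj : j ∈ S <;> simp [hi, hj, this]

/-- the column-selection tail projection for the bisparse structure. -/
theorem stmt5 {n s : ℕ} (hs : s ≤ n)
    (M : Matrix (Fin n) (Fin n) ℝ) (hM : M.IsSymm)
    (Sstar : Finset (Fin n)) (hcard : Sstar.card = s)
    (hmin : ∀ S : Finset (Fin n), S.card = s →
      frobNorm (M - restr M Finset.univ Sstar) ≤ frobNorm (M - restr M Finset.univ S)) :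
    ∀ S : Finset (Fin n), S.card = s →
      frobNorm (M - restr M Sstar Sstar) ≤ Real.sqrt 2 * frobNorm (M - restr M S S) := by
  intro S hS
  calc frobNorm (M - restr M Sstar Sstar)
      ≤ Real.sqrt 2 * frobNorm (M - restr M Finset.univ Sstar) :=
        frobNorm_sub_restr_self_le hM Sstar
    _ ≤ Real.sqrt 2 * frobNorm (M - restr M S S) :=
        mul_le_mul_of_nonneg_left ((hmin S hS).trans (frobNorm_sub_restr_univ_le M S S))
          (Real.sqrt_nonneg 2)
end

section
/- Let M be a symmetric real n×n matrix and let 1 ≤ s ≤ n. Suppose that for each i ∈ {1,…,n}, C_i ⊆ {1,…,n}∖{i} has cardinality s−1 and maximizes Σ_{j∈{i}∪C} M_{i,j}² over all sets C ⊆ {1,…,n}∖{i} of cardinality s−1; set c_i² := Σ_{j∈{i}∪C_i} M_{i,j}². Suppose R ⊆ {1,…,n} has cardinality s and maximizes Σ_{i∈R'} c_i² over all sets R' of cardinality s. Set S' := R ∪ (⋃_{i∈R} C_i). Then |S'| ≤ s², and for every index set S of cardinality s, ‖M_{S×S}‖_F² ≤ ‖M_{S'×S'}‖_F². (That is, this practical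 algorithm is a head projection for Σ_{(s)} into Σ_{(s²)} with constant c_H = 1.) -/
open Matrix Finset MeasureTheory
open scoped ENNReal NNReal

theorem frobNorm_restr_sq {n : ℕ} (M : Matrix (Fin n) (Fin n) ℝ) (S T : Finset (Fin n)) :
    frobNorm (restr M S T) ^ 2 = ∑ i ∈ S, ∑ j ∈ T, (M i j) ^ 2 := by
  rw [frobNorm, Real.sq_sqrt (by positivity)]
  simp [restr, ite_and, ite_pow, Finset.sum_ite_irrel]

/-- Algorithm 1 is a head projection for `Σ_(s)` into `Σ_(s²)` with constant 1. -/
theorem stmt7 {n s : ℕ} (hs1 : 1 ≤ s) (hsn : s ≤ n)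
    (M : Matrix (Fin n) (Fin n) ℝ) (hM : M.IsSymm)
    (C : Fin n → Finset (Fin n))
    (hC : ∀ i, i ∉ C i ∧ (C i).card = s - 1 ∧
      ∀ C' : Finset (Fin n), i ∉ C' → C'.card = s - 1 →
        ∑ j ∈ insert i C', (M i j) ^ 2 ≤ ∑ j ∈ insert i (C i), (M i j) ^ 2)
    (R : Finset (Fin n)) (hR : R.card = s)
    (hRmax : ∀ R' : Finset (Fin n), R'.card = s →
      ∑ i ∈ R', (∑ j ∈ insert i (C i), (M i j) ^ 2) ≤
        ∑ i ∈ R, (∑ j ∈ insert i (C i), (M i j) ^ 2))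
    (S' : Finset (Fin n)) (hS' : S' = R ∪ R.biUnion C) :
    S'.card ≤ s ^ 2 ∧
      ∀ S : Finset (Fin n), S.card = s →
        frobNorm (restr M S S) ^ 2 ≤ frobNorm (restr M S' S') ^ 2 := by
  have hU : S' = R.biUnion fun i => insert i (C i) := by
    subst hS'
    ext j
    simp only [mem_union, mem_biUnion, mem_insert]
    grind
  refine ⟨?_, fun S hS => ?_⟩
  · rw [hU, sq]
    refine (Finset.card_biUnion_le_card_mul R _ s fun i _ => ?_).trans_eq (by rw [hR])
    rw [Finset.card_insert_of_notMem (hC i).1, (hC i).2.1]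
    omega
  · rw [frobNorm_restr_sq, frobNorm_restr_sq]
    calc ∑ i ∈ S, ∑ j ∈ S, (M i j) ^ 2
        ≤ ∑ i ∈ S, ∑ j ∈ insert i (C i), (M i j) ^ 2 := by
          refine Finset.sum_le_sum fun i hi => ?_
          have h := (hC i).2.2 (S.erase i) (Finset.notMem_erase i S)
            (by rw [Finset.card_erase_of_mem hi, hS])
          rwa [Finset.insert_erase hi] at h
      _ ≤ ∑ i ∈ R, ∑ j ∈ insert i (C i), (M i j) ^ 2 := hRmax S hS
      _ ≤ ∑ i ∈ R, ∑ j ∈ S', (M i j) ^ 2 := by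
          refine Finset.sum_le_sum fun i hi =>
            Finset.sum_le_sum_of_subset_of_nonneg ?_ fun _ _ _ => sq_nonneg _
          rw [hU]
          exact Finset.subset_biUnion_of_mem (fun i => insert i (C i)) hi
      _ ≤ ∑ i ∈ S', ∑ j ∈ S', (M i j) ^ 2 :=
          Finset.sum_le_sum_of_subset_of_nonneg (hS' ▸ Finset.subset_union_left)
            fun _ _ _ => by positivity
end

section
/- Let Σ' and Σ'' be sets of real n×n matrices, let C_{T'}, C_{T''} ≥ 1, and let P, T', T'' be maps on n×n matrices such that: P(M) ∈ Σ' ∩ Σ'' and ‖M − P(M)‖_F ≤ ‖M − Z‖_F for all Z ∈ Σ' ∩ Σ'' (exact projection onto Σ' ∩ Σ''); T'(M) ∈ Σ' and ‖M − T'(M)‖_F ≤ C_{T'}·‖M − Z‖_F for all Z ∈ Σ' (tail projection for Σ' with constant C_{T'}); T''(M) ∈ Σ'' and ‖M − T''(M)‖_F ≤ C_{T''}·‖M − Z‖_F for all Z ∈ Σ'' (tail projection for Σ'' with constant C_{T''}); and Σ' is compatible with T'', meaning Z ∈ Σ' implies T''(Z) ∈ Σ'. Then T''∘T' is a tail projection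 for Σ' ∩ Σ'' with constant C_{T'} + C_{T''} + C_{T'}·C_{T''}: for every matrix M, T''(T'(M)) ∈ Σ' ∩ Σ'' and ‖M − T''(T'(M))‖_F ≤ (C_{T'} + C_{T''} + C_{T'}·C_{T''})·‖M − P(M)‖_F. -/
open Matrix Finset MeasureTheory
open scoped ENNReal NNReal

section

attribute [local instance] Matrix.frobeniusNormedAddCommGroup

theorem frobNorm_eq_norm {n : ℕ} (M : Matrix (Fin n) (Fin n) ℝ) : frobNorm M = ‖M‖ := by
  simp [frobNorm, Matrix.frobenius_norm_def, Real.sqrt_eq_rpow]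

theorem frobNorm_sub_comm {n : ℕ} (A B : Matrix (Fin n) (Fin n) ℝ) :
    frobNorm (A - B) = frobNorm (B - A) := by
  simp only [frobNorm_eq_norm, norm_sub_rev]

theorem frobNorm_sub_le {n : ℕ} (A B C : Matrix (Fin n) (Fin n) ℝ) :
    frobNorm (A - C) ≤ frobNorm (A - B) + frobNorm (B - C) := by
  simp only [frobNorm_eq_norm, norm_sub_le_norm_sub_add_norm_sub]

end

/-- composing tail projections for two compatible structures. -/
theorem stmt11 {n : ℕ} (Sig1 Sig2 : Set (Matrix (Fin n) (Fin n) ℝ))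
    (CT' CT'' : ℝ) (h1 : 1 ≤ CT') (h2 : 1 ≤ CT'')
    (P T' T'' : Matrix (Fin n) (Fin n) ℝ → Matrix (Fin n) (Fin n) ℝ)
    (hP : ∀ M, P M ∈ Sig1 ∩ Sig2 ∧
      ∀ Z ∈ Sig1 ∩ Sig2, frobNorm (M - P M) ≤ frobNorm (M - Z))
    (hT' : ∀ M, T' M ∈ Sig1 ∧ ∀ Z ∈ Sig1, frobNorm (M - T' M) ≤ CT' * frobNorm (M - Z))
    (hT'' : ∀ M, T'' M ∈ Sig2 ∧ ∀ Z ∈ Sig2, frobNorm (M - T'' M) ≤ CT'' * frobNorm (M - Z))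
    (hcompat : ∀ Z ∈ Sig1, T'' Z ∈ Sig1) :
    ∀ M : Matrix (Fin n) (Fin n) ℝ, T'' (T' M) ∈ Sig1 ∩ Sig2 ∧
      frobNorm (M - T'' (T' M)) ≤ (CT' + CT'' + CT' * CT'') * frobNorm (M - P M) := by
  intro M
  obtain ⟨hP1, hP2⟩ := (hP M).1
  refine ⟨⟨hcompat _ (hT' M).1, (hT'' _).1⟩, ?_⟩
  have hM : frobNorm (M - T' M) ≤ CT' * frobNorm (M - P M) := (hT' M).2 _ hP1
  have hN : frobNorm (T' M - P M) ≤ CT' * frobNorm (M - P M) + frobNorm (M - P M) := by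
    have := frobNorm_sub_le (T' M) M (P M)
    rw [frobNorm_sub_comm (T' M) M] at this
    linarith
  calc frobNorm (M - T'' (T' M))
      ≤ frobNorm (M - T' M) + frobNorm (T' M - T'' (T' M)) := frobNorm_sub_le _ _ _
    _ ≤ CT' * frobNorm (M - P M) + CT'' * frobNorm (T' M - P M) :=
        add_le_add hM ((hT'' _).2 _ hP2)
    _ ≤ CT' * frobNorm (M - P M) +
          CT'' * (CT' * frobNorm (M - P M) + frobNorm (M - P M)) := by gcongr
    _ = (CT' + CT'' + CT' * CT'') * frobNorm (M - P M) := by ring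
end

section
/- Let v₁, …, v_r ∈ ℝⁿ and let M = Σ_{k=1}^r v_k v_kᵀ (an n×n positive semidefinite matrix of rank at most r). Let 1 ≤ s ≤ n, and suppose that for each k ∈ {1,…,r}, S_k ⊆ {1,…,n} has cardinality s and satisfies Σ_{i∈S} (v_k)_i² ≤ Σ_{i∈S_k} (v_k)_i² for every index set S of cardinality s (i.e., S_k indexes s largest absolute entries of v_k). Set S⋆ := S₁ ∪ ⋯ ∪ S_r, so |S⋆| ≤ rs. Then for every index set S of cardinality s, ‖M_{S⋆×S⋆}‖_F ≥ (1/√r) · ‖M_{S×S}‖_F. (That is, this practical algorithm is a head projection for Σ_{(s)} into Σ_{(rs)} with constant c_H = 1/√r on r-rank positive semidefinite matrices.) -/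
open Matrix Finset MeasureTheory
open scoped ENNReal NNReal

lemma frobNorm_restr_gram {n r : ℕ} (v : Fin r → Fin n → ℝ) (S : Finset (Fin n)) :
    frobNorm (restr (Matrix.of fun i j => ∑ k, v k i * v k j) S S) =
      Real.sqrt (∑ k, ∑ l, (∑ i ∈ S, v k i * v l i) ^ 2) := by
  unfold frobNorm
  congr 1
  have h1 : ∀ k l, (∑ i ∈ S, v k i * v l i) ^ 2 =
      ∑ i ∈ S, ∑ j ∈ S, (v k i * v k j) * (v l i * v l j) := by
    intro k l
    rw [sq, Finset.sum_mul_sum]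
    exact Finset.sum_congr rfl fun i _ => Finset.sum_congr rfl fun j _ => by ring
  have h2 : ∀ i j, (restr (Matrix.of fun i j => ∑ k, v k i * v k j) S S i j) ^ 2 =
      if i ∈ S then
        if j ∈ S then ∑ k, ∑ l, (v k i * v k j) * (v l i * v l j) else 0
      else 0 := by
    intro i j
    by_cases hi : i ∈ S <;> by_cases hj : j ∈ S <;>
      simp [restr, hi, hj, sq, Finset.sum_mul_sum]
  have h3 : ∑ i, ∑ j, (restr (Matrix.of fun i j => ∑ k, v k i * v k j) S S i j) ^ 2 =
      ∑ i ∈ S, ∑ j ∈ S, ∑ k, ∑ l, (v k i * v k j) * (v l i * v l j) := by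
    simp_rw [h2]
    rw [← Finset.sum_subset (Finset.subset_univ S) fun i _ hi => by simp [hi]]
    refine Finset.sum_congr rfl fun i hi => ?_
    simp [hi]
  rw [h3]
  simp_rw [h1]
  rw [← Finset.sum_product' S S, Finset.sum_comm]
  refine Finset.sum_congr rfl fun k _ => ?_
  rw [Finset.sum_comm]
  exact Finset.sum_congr rfl fun l _ => Finset.sum_product' S S
    fun i j => v k i * v k j * (v l i * v l j)

/-- head projection for rank-`r` positive semidefinite matrices. -/
theorem stmt12 {n r s : ℕ} (hr : 1 ≤ r) (hs1 : 1 ≤ s) (hsn : s ≤ n)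
    (v : Fin r → Fin n → ℝ)
    (M : Matrix (Fin n) (Fin n) ℝ) (hM : M = Matrix.of fun i j => ∑ k, v k i * v k j)
    (Sk : Fin r → Finset (Fin n))
    (hSk : ∀ k, (Sk k).card = s ∧ ∀ S : Finset (Fin n), S.card = s →
      ∑ i ∈ S, (v k i) ^ 2 ≤ ∑ i ∈ Sk k, (v k i) ^ 2)
    (Sstar : Finset (Fin n)) (hSstar : Sstar = Finset.univ.biUnion Sk) :
    ∀ S : Finset (Fin n), S.card = s →
      frobNorm (restr M Sstar Sstar) ≥ (1 / Real.sqrt r) * frobNorm (restr M S S) := by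
  intro S hS
  subst hM
  rw [frobNorm_restr_gram, frobNorm_restr_gram, ge_iff_le, one_div]
  have hr0 : (0 : ℝ) < r := by exact_mod_cast hr
  rw [inv_mul_le_iff₀ (Real.sqrt_pos.mpr hr0), ← Real.sqrt_mul hr0.le]
  apply Real.sqrt_le_sqrt
  have hab : ∀ k, ∑ i ∈ S, (v k i) ^ 2 ≤ ∑ i ∈ Sstar, v k i * v k i := by
    intro k
    refine ((hSk k).2 S hS).trans ?_
    simp_rw [← sq]
    refine Finset.sum_le_sum_of_subset_of_nonneg ?_ fun i _ _ => sq_nonneg _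
    rw [hSstar]
    exact Finset.subset_biUnion_of_mem Sk (Finset.mem_univ k)
  calc ∑ k, ∑ l, (∑ i ∈ S, v k i * v l i) ^ 2
      ≤ ∑ k, ∑ l, (∑ i ∈ S, (v k i) ^ 2) * ∑ i ∈ S, (v l i) ^ 2 :=
        Finset.sum_le_sum fun k _ => Finset.sum_le_sum fun l _ =>
          Finset.sum_mul_sq_le_sq_mul_sq S (v k) (v l)
    _ = (∑ k, ∑ i ∈ S, (v k i) ^ 2) ^ 2 := by rw [sq, Finset.sum_mul_sum]
    _ ≤ r * ∑ k, (∑ i ∈ S, (v k i) ^ 2) ^ 2 := by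
        simpa using sq_sum_le_card_mul_sum_sq (s := Finset.univ)
          (f := fun k => ∑ i ∈ S, (v k i) ^ 2)
    _ ≤ r * ∑ k, ∑ l, (∑ i ∈ Sstar, v k i * v l i) ^ 2 := by
        refine mul_le_mul_of_nonneg_left (Finset.sum_le_sum fun k _ => ?_) hr0.le
        calc (∑ i ∈ S, (v k i) ^ 2) ^ 2 ≤ (∑ i ∈ Sstar, v k i * v k i) ^ 2 :=
              pow_le_pow_left₀ (Finset.sum_nonneg fun i _ => sq_nonneg _) (hab k) 2
          _ ≤ ∑ l, (∑ i ∈ Sstar, v k i * v l i) ^ 2 :=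
              Finset.single_le_sum (f := fun l => (∑ i ∈ Sstar, v k i * v l i) ^ 2)
                (fun l _ => sq_nonneg _) (Finset.mem_univ k)
end

section
/- Let M be a symmetric real n×n matrix and let 1 ≤ r ≤ s ≤ n. Suppose S⋆ ⊆ {1,…,n} has cardinality s and satisfies ‖M_{S⋆×S⋆}‖_F² ≥ (1/s)·‖M_{S×S}‖_F² for every index set S of cardinality s (such an S⋆ exists and is computable by a practical algorithm). Then for every index set S of cardinality s, every best rank-r Frobenius approximation Y⋆ of M_{S⋆×S⋆} and every best rank-r Frobenius approximation Y_S of M_{S×S} satisfy ‖Y⋆‖_F² ≥ (r/s²)·‖Y_S‖_F². (That is, composing this head projection with the best rank-r approximation yields a head projection for Σ_{(s)}^{[r]} with constant c_H = √r/s.) -/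
open Matrix Finset MeasureTheory
open scoped ENNReal NNReal

lemma frobNorm_sq {n : ℕ} (A : Matrix (Fin n) (Fin n) ℝ) :
    frobNorm A ^ 2 = ∑ i, ∑ j, A i j ^ 2 :=
  Real.sq_sqrt (Finset.sum_nonneg fun _ _ => Finset.sum_nonneg fun _ _ => sq_nonneg _)

lemma frobNorm_nonneg {n : ℕ} (A : Matrix (Fin n) (Fin n) ℝ) : 0 ≤ frobNorm A :=
  Real.sqrt_nonneg _

lemma frobNorm_sub_smul_sq {n : ℕ} (A Y : Matrix (Fin n) (Fin n) ℝ) (t : ℝ) :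
    frobNorm (A - t • Y) ^ 2 =
      frobNorm A ^ 2 - 2 * t * frobInner A Y + t ^ 2 * frobNorm Y ^ 2 := by
  simp only [frobNorm_sq, frobInner, Finset.mul_sum, ← Finset.sum_sub_distrib,
    ← Finset.sum_add_distrib, Matrix.sub_apply, Matrix.smul_apply, smul_eq_mul]
  refine Finset.sum_congr rfl fun i _ => Finset.sum_congr rfl fun j _ => ?_
  ring

lemma IsBestRankApprox.frobNorm_sub_sq_le {n r : ℕ} {A Y Z : Matrix (Fin n) (Fin n) ℝ}
    (h : IsBestRankApprox r A Y) (hZ : Z.rank ≤ r) :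
    frobNorm (A - Y) ^ 2 ≤ frobNorm (A - Z) ^ 2 :=
  pow_le_pow_left₀ (frobNorm_nonneg _) (h.2 Z hZ) 2

/-- A best rank-`r` approximation is orthogonal to its residual, since all its scalar multiples
are competitors. -/
lemma IsBestRankApprox.frobInner_eq {n r : ℕ} {A Y : Matrix (Fin n) (Fin n) ℝ}
    (h : IsBestRankApprox r A Y) : frobInner A Y = frobNorm Y ^ 2 := by
  have key : ∀ t : ℝ, -(2 * frobInner A Y) + frobNorm Y ^ 2 ≤
      -(2 * t * frobInner A Y) + t ^ 2 * frobNorm Y ^ 2 := by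
    intro t
    have hrank : (t • Y).rank ≤ r := by
      rw [Matrix.smul_eq_diagonal_mul]
      exact (Matrix.rank_mul_le_right _ _).trans h.1
    have h1 := h.frobNorm_sub_sq_le hrank
    have h2 := frobNorm_sub_smul_sq A Y 1
    rw [one_smul] at h2
    rw [h2, frobNorm_sub_smul_sq] at h1
    linarith
  rcases (sq_nonneg (frobNorm Y)).eq_or_lt with hc | hc
  · have h0 := key 0
    have h2 := key 2
    rw [← hc] at h0 h2 ⊢
    linarith
  · have ht := key (frobInner A Y / frobNorm Y ^ 2)
    have hquot : -(2 * (frobInner A Y / frobNorm Y ^ 2) * frobInner A Y) +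
        (frobInner A Y / frobNorm Y ^ 2) ^ 2 * frobNorm Y ^ 2 =
        -(frobInner A Y ^ 2 / frobNorm Y ^ 2) := by
      field_simp
      ring
    rw [hquot, le_neg, div_le_iff₀ hc] at ht
    have hsq : (frobInner A Y - frobNorm Y ^ 2) ^ 2 ≤ 0 := by linarith
    exact sub_eq_zero.mp (pow_eq_zero_iff two_ne_zero |>.mp (le_antisymm hsq (sq_nonneg _)))

lemma IsBestRankApprox.frobNorm_sq_eq {n r : ℕ} {A Y : Matrix (Fin n) (Fin n) ℝ}
    (h : IsBestRankApprox r A Y) :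
    frobNorm Y ^ 2 = frobNorm A ^ 2 - frobNorm (A - Y) ^ 2 := by
  have h2 := frobNorm_sub_smul_sq A Y 1
  rw [one_smul, h.frobInner_eq] at h2
  linarith

/-- Some `r`-element subset carries at least the fraction `r / #S` of a sum over `S`. -/
lemma exists_subset_card_mul_sum_le {ι : Type*} [DecidableEq ι] (f : ι → ℝ) {r s : ℕ}
    (hr : 1 ≤ r) (hrs : r ≤ s) : ∀ S : Finset ι, S.card = s →
      ∃ T ⊆ S, T.card = r ∧ (r : ℝ) * ∑ i ∈ S, f i ≤ s * ∑ i ∈ T, f i := by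
  induction s, hrs using Nat.le_induction with
  | base => exact fun S hS => ⟨S, Finset.Subset.refl S, hS, le_rfl⟩
  | succ s hs ih =>
    intro S hS
    obtain ⟨x, hx, hmin⟩ := S.exists_min_image f (Finset.card_pos.mp (by omega))
    obtain ⟨T, hTS, hT, hle⟩ := ih (S.erase x) (by rw [Finset.card_erase_of_mem hx]; omega)
    refine ⟨T, hTS.trans (Finset.erase_subset x S), hT, ?_⟩
    have havg := Finset.card_nsmul_le_sum S f (f x) hmin
    rw [hS, nsmul_eq_mul] at havg
    rw [← Finset.add_sum_erase S f hx] at havg ⊢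
    push_cast at havg ⊢
    have hs0 : (0 : ℝ) < s := by exact_mod_cast (by omega : 0 < s)
    have hr0 : (0 : ℝ) ≤ r := r.cast_nonneg
    refine le_of_mul_le_mul_left ?_ hs0
    have h1 := mul_le_mul_of_nonneg_left havg hr0
    have h2 := mul_le_mul_of_nonneg_left hle (by positivity : (0 : ℝ) ≤ s + 1)
    linarith

/-- Keeping the rows indexed by `T` gives a matrix of rank at most `#T`. -/
lemma rank_restr_univ_le {n : ℕ} (A : Matrix (Fin n) (Fin n) ℝ) (T : Finset (Fin n)) :
    (restr A T Finset.univ).rank ≤ T.card := by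
  have h : restr A T Finset.univ =
      Matrix.diagonal (fun i => if i ∈ T then (1 : ℝ) else 0) * A := by
    ext i j
    simp [restr, Matrix.diagonal_mul]
  rw [h]
  refine (Matrix.rank_mul_le_left _ _).trans ?_
  rw [Matrix.rank_diagonal]
  simp

lemma frobNorm_sub_restr_univ_sq {n : ℕ} (A : Matrix (Fin n) (Fin n) ℝ) (T : Finset (Fin n)) :
    frobNorm (A - restr A T Finset.univ) ^ 2 =
      frobNorm A ^ 2 - ∑ i ∈ T, ∑ j, A i j ^ 2 := by
  rw [frobNorm_sq, frobNorm_sq, ← Finset.sum_add_sum_compl T (fun i => ∑ j, A i j ^ 2),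
    add_sub_cancel_left, ← Finset.sum_add_sum_compl T]
  have h1 : ∑ i ∈ T, ∑ j, (A - restr A T Finset.univ) i j ^ 2 = 0 :=
    Finset.sum_eq_zero fun i hi => Finset.sum_eq_zero fun j _ => by simp [restr, hi]
  rw [h1, zero_add]
  refine Finset.sum_congr rfl fun i hi => Finset.sum_congr rfl fun j _ => ?_
  simp [restr, Finset.mem_compl.mp hi]

lemma IsBestRankApprox.card_mul_frobNorm_sq_ge {n r : ℕ} {M Y : Matrix (Fin n) (Fin n) ℝ}
    {S : Finset (Fin n)} (hr : 1 ≤ r) (hrS : r ≤ S.card)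
    (h : IsBestRankApprox r (restr M S S) Y) :
    r * frobNorm (restr M S S) ^ 2 ≤ S.card * frobNorm Y ^ 2 := by
  obtain ⟨T, -, hT, hle⟩ :=
    exists_subset_card_mul_sum_le (fun i => ∑ j, restr M S S i j ^ 2) hr hrS S rfl
  have hsupp : ∑ i ∈ S, ∑ j, restr M S S i j ^ 2 = frobNorm (restr M S S) ^ 2 := by
    rw [frobNorm_sq]
    refine Finset.sum_subset (Finset.subset_univ S) fun i _ hi => ?_
    exact Finset.sum_eq_zero fun j _ => by simp [restr, hi]
  rw [hsupp] at hle
  have hres := h.frobNorm_sub_sq_le ((rank_restr_univ_le (restr M S S) T).trans hT.le)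
  rw [frobNorm_sub_restr_univ_sq] at hres
  refine hle.trans (mul_le_mul_of_nonneg_left ?_ (Nat.cast_nonneg _))
  linarith [h.frobNorm_sq_eq]

/-- a head projection for `Σ_{(s)}^{[r]}` with constant `√r/s`. -/
theorem stmt14 {n r s : ℕ} (hr : 1 ≤ r) (hrs : r ≤ s) (hsn : s ≤ n)
    (M : Matrix (Fin n) (Fin n) ℝ) (hM : M.IsSymm)
    (Sstar : Finset (Fin n)) (hcard : Sstar.card = s)
    (hhead : ∀ S : Finset (Fin n), S.card = s →
      frobNorm (restr M Sstar Sstar) ^ 2 ≥ (1 / (s : ℝ)) * frobNorm (restr M S S) ^ 2) :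
    ∀ S : Finset (Fin n), S.card = s →
      ∀ Ystar YS : Matrix (Fin n) (Fin n) ℝ,
        IsBestRankApprox r (restr M Sstar Sstar) Ystar →
        IsBestRankApprox r (restr M S S) YS →
        frobNorm Ystar ^ 2 ≥ ((r : ℝ) / (s : ℝ) ^ 2) * frobNorm YS ^ 2 := by
  intro S hS Ystar YS hstar hYS
  have hs0 : (0 : ℝ) < s := by exact_mod_cast (by omega : 0 < s)
  have h1 := hstar.card_mul_frobNorm_sq_ge hr (hcard.symm ▸ hrs)
  rw [hcard] at h1
  have h2 := hhead S hS
  have h3 : frobNorm YS ^ 2 ≤ frobNorm (restr M S S) ^ 2 := by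
    linarith [hYS.frobNorm_sq_eq, sq_nonneg (frobNorm (restr M S S - YS))]
  calc (r : ℝ) / (s : ℝ) ^ 2 * frobNorm YS ^ 2
      ≤ r / (s : ℝ) ^ 2 * frobNorm (restr M S S) ^ 2 := by gcongr
    _ = r / s * (1 / s * frobNorm (restr M S S) ^ 2) := by field_simp
    _ ≤ r / s * frobNorm (restr M Sstar Sstar) ^ 2 := by gcongr
    _ ≤ frobNorm Ystar ^ 2 := by
      rw [div_mul_eq_mul_div, div_le_iff₀ hs0]
      linarith
end

section
/- Let M be a symmetric real n×n matrix, let 1 ≤ r and 1 ≤ s ≤ n, and let S⋆ be an index set of cardinality s. Suppose Y is a symmetric best rank-r Frobenius approximation of M_{S⋆×S⋆} which is a best approximation of M from Σ_{(s)}^{[r]}, i.e., Y ∈ Σ_{(s)}^{[r]} and ‖M − Y‖_F ≤ ‖M − Z‖_F for all Z ∈ Σ_{(s)}^{[r]}. Then for every index set S' with S' ⊇ S⋆, Y is also a best approximation of M_{S'×S'} from Σ_{(s)}^{[r]}: ‖M_{S'×S'} − Y‖_F ≤ ‖M_{S'×S'} − Z‖_F for all Z ∈ Σ_{(s)}^{[r]}.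 -/
open Matrix Finset MeasureTheory
open scoped ENNReal NNReal

theorem frobNorm_le_frobNorm_iff {n : ℕ} (A B : Matrix (Fin n) (Fin n) ℝ) :
    frobNorm A ≤ frobNorm B ↔ ∑ i, ∑ j, (A i j) ^ 2 ≤ ∑ i, ∑ j, (B i j) ^ 2 :=
  Real.sqrt_le_sqrt_iff (Finset.sum_nonneg fun _ _ => Finset.sum_nonneg fun _ _ => sq_nonneg _)

theorem restr_eq_diagonal_mul_mul_diagonal {n : ℕ} (M : Matrix (Fin n) (Fin n) ℝ)
    (S T : Finset (Fin n)) :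
    restr M S T = Matrix.diagonal (fun i => if i ∈ S then (1 : ℝ) else 0) * M *
      Matrix.diagonal (fun i => if i ∈ T then (1 : ℝ) else 0) := by
  ext i j
  by_cases hi : i ∈ S <;> by_cases hj : j ∈ T <;> simp [restr, hi, hj]

theorem rank_restr_le {n : ℕ} (M : Matrix (Fin n) (Fin n) ℝ) (S T : Finset (Fin n)) :
    (restr M S T).rank ≤ M.rank := by
  rw [restr_eq_diagonal_mul_mul_diagonal]
  exact (Matrix.rank_mul_le_left _ _).trans (Matrix.rank_mul_le_right _ _)

theorem restr_mem_SigmaRS {n r s : ℕ} {Z : Matrix (Fin n) (Fin n) ℝ} (hZ : Z ∈ SigmaRS n r s)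
    (S : Finset (Fin n)) : restr Z S S ∈ SigmaRS n r s := by
  obtain ⟨hsymm, hrank, T, hT, hZT⟩ := hZ
  refine ⟨?_, (rank_restr_le Z S S).trans hrank, T, hT, ?_⟩
  · ext i j
    simp [restr, hsymm.apply i j, and_comm]
  · ext i j
    have h := congrFun (congrFun hZT i) j
    by_cases hij : i ∈ T ∧ j ∈ T
    · simp [restr, hij]
    · simp only [restr, Matrix.of_apply, if_neg hij] at h ⊢
      simp [h]

/-- A best rank-`r` approximation of a matrix supported on `S × T` vanishes off `S × T`. -/
theorem IsBestRankApprox.apply_eq_zero {n r : ℕ} {M Y : Matrix (Fin n) (Fin n) ℝ}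
    {S T : Finset (Fin n)} (h : IsBestRankApprox r (restr M S T) Y) {i j : Fin n}
    (hij : ¬(i ∈ S ∧ j ∈ T)) : Y i j = 0 := by
  have hle := (frobNorm_le_frobNorm_iff _ _).1
    (h.2 (restr Y S T) ((rank_restr_le Y S T).trans h.1))
  by_contra hne
  have hterm : ∀ a b, ((restr M S T - restr Y S T) a b) ^ 2 ≤ ((restr M S T - Y) a b) ^ 2 := by
    intro a b
    by_cases hab : a ∈ S ∧ b ∈ T <;> simp [restr, hab, sq_nonneg]
  refine hle.not_gt (Finset.sum_lt_sum (fun a _ => Finset.sum_le_sum fun b _ => hterm a b)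
    ⟨i, Finset.mem_univ i, Finset.sum_lt_sum (fun b _ => hterm i b) ⟨j, Finset.mem_univ j, ?_⟩⟩)
  simp only [restr, Matrix.sub_apply, Matrix.of_apply, if_neg hij]
  have := pow_pos (abs_pos.2 hne) 2
  rw [sq_abs] at this
  linarith

/-- the projection onto `Σ_{(s)}^{[r]}` is unchanged when restricting to a
larger support. -/
theorem stmt19 {n r s : ℕ} (hr : 1 ≤ r) (hs1 : 1 ≤ s) (hsn : s ≤ n)
    (M : Matrix (Fin n) (Fin n) ℝ) (hM : M.IsSymm)
    (Sstar : Finset (Fin n)) (hcard : Sstar.card = s)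
    (Y : Matrix (Fin n) (Fin n) ℝ) (hYsymm : Y.IsSymm)
    (hYbest : IsBestRankApprox r (restr M Sstar Sstar) Y)
    (hYmem : Y ∈ SigmaRS n r s)
    (hYproj : ∀ Z ∈ SigmaRS n r s, frobNorm (M - Y) ≤ frobNorm (M - Z)) :
    ∀ S' : Finset (Fin n), Sstar ⊆ S' →
      ∀ Z ∈ SigmaRS n r s,
        frobNorm (restr M S' S' - Y) ≤ frobNorm (restr M S' S' - Z) := by
  intro S' hS Z hZ
  have hle := (frobNorm_le_frobNorm_iff _ _).1 (hYproj _ (restr_mem_SigmaRS hZ S'))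
  rw [frobNorm_le_frobNorm_iff]
  have hterm : ∀ i j, ((restr M S' S' - Y) i j) ^ 2 + ((M - restr Z S' S') i j) ^ 2 ≤
      ((restr M S' S' - Z) i j) ^ 2 + ((M - Y) i j) ^ 2 := by
    intro i j
    by_cases hij : i ∈ S' ∧ j ∈ S'
    · simp only [restr, Matrix.sub_apply, Matrix.of_apply, if_pos hij]
      linarith
    · have hY : Y i j = 0 := hYbest.apply_eq_zero fun h => hij ⟨hS h.1, hS h.2⟩
      simp only [restr, Matrix.sub_apply, Matrix.of_apply, if_neg hij, hY]
      nlinarith [sq_nonneg (Z i j)]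
  have hsum := Finset.sum_le_sum fun i (_ : i ∈ Finset.univ) =>
    Finset.sum_le_sum fun j (_ : j ∈ Finset.univ) => hterm i j
  simp only [Finset.sum_add_distrib] at hsum
  linarith
end
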